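/- Let q ∈ ℂ[z,ζ] be a nonconstant Hermitian homogeneous polynomial, and set Q := q·(∂_z ∂_ζ q) − (∂_z q)(∂_ζ q). If q is not of the form c₀ z^m ζ^m for a real c₀ and integer m ≥ 1, then the rational function [q^{-1}∂_z∂_ζ]² (q^{-3}Q) − q^{-4}Q ∂_z∂_ζ(q^{-3}Q) − q^{-1} (∂_ζ(q^{-3}Q)) (∂_z(q^{-3}Q)) is not identically zero. -/

import Mathlib

open MvPolynomial

/-- `Qpoly q = q·∂_z∂_ζ q − (∂_z q)(∂_ζ q)`. -/
noncomputable def Qpoly (q : MvPolynomial (Fin 2) ℂ) : MvPolynomial (Fin 2) ℂ :=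
  q * pderiv 0 (pderiv 1 q) - pderiv 0 q * pderiv 1 q

/-- Numerator of `∂_z (q⁻³ Qpoly)`, whose denominator is `q⁴`. -/
noncomputable def Az (q : MvPolynomial (Fin 2) ℂ) : MvPolynomial (Fin 2) ℂ :=
  q * pderiv 0 (Qpoly q) - 3 * Qpoly q * pderiv 0 q

/-- Numerator of `∂_ζ (q⁻³ Qpoly)`, whose denominator is `q⁴`. -/
noncomputable def Aζ (q : MvPolynomial (Fin 2) ℂ) : MvPolynomial (Fin 2) ℂ :=
  q * pderiv 1 (Qpoly q) - 3 * Qpoly q * pderiv 1 q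

/-- Numerator of `∂_z ∂_ζ (q⁻³ Qpoly)`, whose denominator is `q⁵`. -/
noncomputable def Mp (q : MvPolynomial (Fin 2) ℂ) : MvPolynomial (Fin 2) ℂ :=
  q * pderiv 0 (Aζ q) - 4 * Aζ q * pderiv 0 q

/-- Numerator of `∂_ζ (q⁻¹∂_z∂_ζ (q⁻³ Qpoly))`, whose denominator is `q⁷`. -/
noncomputable def Np (q : MvPolynomial (Fin 2) ℂ) : MvPolynomial (Fin 2) ℂ :=
  q * pderiv 1 (Mp q) - 6 * Mp q * pderiv 1 q

/-- Numerator of `∂_z∂_ζ (q⁻¹∂_z∂_ζ (q⁻³ Qpoly))`, whose denominator is `q⁸`. -/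
noncomputable def Lp (q : MvPolynomial (Fin 2) ℂ) : MvPolynomial (Fin 2) ℂ :=
  q * pderiv 0 (Np q) - 7 * Np q * pderiv 0 q

/-- Numerator (over the denominator `q⁹`) of the rational function
`[q⁻¹∂_z∂_ζ]²(q⁻³Q) − q⁻⁴Q·∂_z∂_ζ(q⁻³Q) − q⁻¹·(∂_ζ(q⁻³Q))·(∂_z(q⁻³Q))`.
Since the polynomial ring is an integral domain and `q ≠ 0`, this rational function
vanishes identically iff `b3num q = 0`. -/
noncomputable def b3num (q : MvPolynomial (Fin 2) ℂ) : MvPolynomial (Fin 2) ℂ :=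
  Lp q - Qpoly q * Mp q - Aζ q * Az q

/-- `P = L ^ n * (c * h ^ j + O(L))`: the leading term of `P` along the divisor `L = 0`. -/
def HasLeadingTerm (L h P : MvPolynomial (Fin 2) ℂ) (n : ℕ) (c : ℂ) (j : ℕ) : Prop :=
  ∃ r, P = L ^ n * (C c * h ^ j + L * r)

namespace HasLeadingTerm

variable {L h P P₂ : MvPolynomial (Fin 2) ℂ} {n n₂ j j₂ k : ℕ} {c c₂ e : ℂ} {i : Fin 2}

lemma mul (hP : HasLeadingTerm L h P n c j) (hP₂ : HasLeadingTerm L h P₂ n₂ c₂ j₂) :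
    HasLeadingTerm L h (P * P₂) (n + n₂) (c * c₂) (j + j₂) := by
  obtain ⟨r, rfl⟩ := hP
  obtain ⟨s, rfl⟩ := hP₂
  refine ⟨C c * h ^ j * s + C c₂ * h ^ j₂ * r + L * r * s, ?_⟩
  rw [C_mul]
  ring

lemma sub (hP : HasLeadingTerm L h P n c j) (hP₂ : HasLeadingTerm L h P₂ n c₂ j) :
    HasLeadingTerm L h (P - P₂) n (c - c₂) j := by
  obtain ⟨r, rfl⟩ := hP
  obtain ⟨s, rfl⟩ := hP₂
  refine ⟨r - s, ?_⟩
  rw [C_sub]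
  ring

lemma mul_pderiv_pow_mul (hL : pderiv i L = C e) (n : ℕ) (p : MvPolynomial (Fin 2) ℂ) :
    L * pderiv i (L ^ n * p) =
      L ^ n * (n * (C e : MvPolynomial (Fin 2) ℂ) * p + L * pderiv i p) := by
  rw [pderiv_mul, pderiv_pow, hL]
  cases n with
  | zero => simp
  | succ n => simp; ring

lemma pderiv_pow_succ_mul (hL : pderiv i L = C e) (k : ℕ) :
    HasLeadingTerm L h (pderiv i (L ^ (k + 1) * h)) k ((k + 1) * e) 1 := by
  refine ⟨pderiv i h, ?_⟩
  rw [pderiv_mul, pderiv_pow, hL]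
  simp
  ring

/-- The effect on leading terms of the numerator operation of the quotient rule for `P / q ^ m`,
where `q = L ^ (k + 1) * h`. -/
lemma quotient_rule (hL : pderiv i L = C e) (hP : HasLeadingTerm L h P n c j) (m : ℕ) :
    HasLeadingTerm L h
      (L ^ (k + 1) * h * pderiv i P - m * P * pderiv i (L ^ (k + 1) * h))
      (n + k) ((n - m * (k + 1)) * e * c) (j + 1) := by
  obtain ⟨r, hr⟩ := hP
  set p := C c * h ^ j + L * r with hp
  have h₁ := mul_pderiv_pow_mul hL n p
  have h₂ : pderiv i (L ^ (k + 1) * h) = L ^ k * ((k + 1) * (C e : MvPolynomial (Fin 2) ℂ) * h +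
      L * pderiv i h) := by
    rw [pderiv_mul, pderiv_pow, hL]
    simp
    ring
  refine ⟨(n - m * (k + 1)) * (C e : MvPolynomial (Fin 2) ℂ) * h * r + h * pderiv i p
    - m * p * pderiv i h, ?_⟩
  rw [h₂, hr]
  simp only [C_mul, C_sub, C_add, C_1, map_natCast]
  linear_combination L ^ k * h * h₁ + L ^ (n + k) * h * (n - m * (k + 1)) * C e * hp

lemma ne_zero (hP : HasLeadingTerm L h P n c j) (hL : Prime L) (hh : ¬ L ∣ h) (hc : c ≠ 0) :
    P ≠ 0 := by
  obtain ⟨r, rfl⟩ := hP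
  refine mul_ne_zero (pow_ne_zero _ hL.ne_zero) fun h0 ↦ hh ?_
  have hdvd : L ∣ C c * h ^ j := ⟨-r, by linear_combination h0⟩
  have hunit : IsUnit (C c : MvPolynomial (Fin 2) ℂ) := (isUnit_iff_ne_zero.2 hc).map C
  exact hL.dvd_of_dvd_pow (hunit.dvd_mul_left.1 hdvd)

end HasLeadingTerm

lemma hasLeadingTerm_b3num {L h : MvPolynomial (Fin 2) ℂ} {a : ℂ} (h0 : pderiv 0 L = C 1)
    (h1 : pderiv 1 L = C (-a)) (k : ℕ) :
    HasLeadingTerm L h (b3num (L ^ (k + 1) * h)) (6 * k)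
      ((k + 1) * a ^ 3 * ((k + 3) * ((2 * k + 7) * (2 * k + 6) * (k + 4) + (k + 4) * (k + 1)
        + (k + 3) * (k + 1)))) 6 := by
  set q := L ^ (k + 1) * h with hq
  have hQ : HasLeadingTerm L h (Qpoly q) (k + k) ((k + 1) * a) 2 := by
    convert (HasLeadingTerm.pderiv_pow_succ_mul (h := h) h1 k).quotient_rule (k := k) h0 1 using 1
    · rw [Qpoly, Nat.cast_one, one_mul, mul_comm (pderiv 0 q)]
    · push_cast
      ring
  have hAz : HasLeadingTerm L h (Az q) _ _ 3 := hQ.quotient_rule (k := k) h0 3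
  have hAζ : HasLeadingTerm L h (Aζ q) _ _ 3 := hQ.quotient_rule (k := k) h1 3
  have hM : HasLeadingTerm L h (Mp q) _ _ 4 := hAζ.quotient_rule (k := k) h0 4
  have hN : HasLeadingTerm L h (Np q) _ _ 5 := hM.quotient_rule (k := k) h1 6
  have hLp : HasLeadingTerm L h (Lp q) _ _ 6 := hN.quotient_rule (k := k) h0 7
  have hQM := hQ.mul hM
  have hAA := hAζ.mul hAz
  rw [show k + k + (k + k + k + k) = k + k + k + k + k + k by ring] at hQM
  rw [show k + k + k + (k + k + k) = k + k + k + k + k + k by ring] at hAA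
  convert (hLp.sub hQM).sub hAA using 1
  · rfl
  · ring
  · push_cast
    ring

lemma prime_X_sub_C_mul_X (a : ℂ) : Prime (X 0 - C a * X 1 : MvPolynomial (Fin 2) ℂ) := by
  set L : MvPolynomial (Fin 2) ℂ := X 0 - C a * X 1 with hL
  let φ : MvPolynomial (Fin 2) ℂ →ₐ[ℂ] MvPolynomial (Fin 2) ℂ := aeval ![C a * X 1, X 1]
  have hφL : φ L = 0 := by simp [φ, hL, algHom_C]
  have key (p : MvPolynomial (Fin 2) ℂ) : L ∣ p ↔ φ p = 0 := by
    constructor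
    · rintro ⟨r, rfl⟩
      rw [map_mul, hφL, zero_mul]
    · intro hp
      suffices h : L ∣ p - φ p by simpa [hp] using h
      clear hp
      induction p using MvPolynomial.induction_on with
      | C c => simp [algHom_C]
      | add p r hp hr =>
        rw [map_add, add_sub_add_comm]
        exact dvd_add hp hr
      | mul_X p i hp =>
        have hX : L ∣ X i - φ (X i) := by fin_cases i <;> simp [φ, hL]
        have := dvd_add (hp.mul_right (X i)) (hX.mul_left (φ p))
        rw [map_mul]
        convert this using 1
        ring
  refine ⟨fun h ↦ ?_, fun h ↦ ?_, fun p r h ↦ ?_⟩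
  · have := congrArg (eval ![a + 1, 1]) h
    simp [hL] at this
  · have := (key 1).1 h.dvd
    simp at this
  · simpa [key] using h

/-- A binary form over `ℂ` is a monomial or has a linear factor other than the variables. -/
lemma exists_eq_monomial_or_linear_dvd {q : MvPolynomial (Fin 2) ℂ} {d : ℕ}
    (hhom : q.IsHomogeneous d) (hq : q ≠ 0) :
    (∃ (c : ℂ) (i j : ℕ), q = C c * (X 0 ^ i * X 1 ^ j)) ∨
      ∃ a : ℂ, a ≠ 0 ∧ X 0 - C a * X 1 ∣ q := by
  set f : Polynomial ℂ := aeval ![Polynomial.X, 1] q with hf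
  have hfq : f.homogenize d = q := Polynomial.homogenize_eq_of_isHomogeneous hhom rfl
  have hf0 : f ≠ 0 := by
    intro h
    exact hq (by rw [← hfq, h, Polynomial.homogenize_zero])
  by_cases hroot : ∃ a : ℂ, a ≠ 0 ∧ f.IsRoot a
  · right
    obtain ⟨a, ha, hfa⟩ := hroot
    refine ⟨a, ha, ?_⟩
    obtain ⟨g, hg⟩ := Polynomial.dvd_iff_isRoot.2 hfa
    have hdeg : f.natDegree ≤ d := by
      rw [hf, aeval_def, eval₂_eq']
      refine Polynomial.natDegree_sum_le_of_forall_le _ _ fun m hm ↦ ?_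
      have hm₂ : m 0 + m 1 = d := by
        simpa [Finsupp.weight_apply, Finsupp.sum_fintype] using hhom (mem_support_iff.1 hm)
      refine (Polynomial.natDegree_C_mul_le _ _).trans ?_
      simp
      omega
    have hg0 : g ≠ 0 := by rintro rfl; exact hf0 (by rw [hg, mul_zero])
    have hfdeg : f.natDegree = 1 + g.natDegree := by
      rw [hg, Polynomial.natDegree_mul (Polynomial.X_sub_C_ne_zero a) hg0,
        Polynomial.natDegree_X_sub_C]
    have hd : d = 1 + (d - 1) := by omega
    rw [← hfq, hg, hd, Polynomial.homogenize_mul _ _ (by simp) (by omega)]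
    simp
  · left
    push Not at hroot
    obtain ⟨g, hg, hXg⟩ := Polynomial.exists_eq_pow_rootMultiplicity_mul_and_not_dvd f hf0 0
    set i := f.rootMultiplicity 0
    have hgdeg : g.degree = 0 := by
      by_contra hne
      obtain ⟨a, ha⟩ := IsAlgClosed.exists_root g hne
      have ha0 : a ≠ 0 := by
        rintro rfl
        exact hXg (Polynomial.dvd_iff_isRoot.2 ha)
      refine hroot a ha0 ?_
      rw [hg, Polynomial.IsRoot, Polynomial.eval_mul, ha.eq_zero, mul_zero]
    rw [Polynomial.eq_C_of_degree_eq_zero hgdeg, Polynomial.C_0, sub_zero, mul_comm] at hg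
    have hi : i ≤ d := by
      by_contra! hi
      refine hq ?_
      rw [← hfq, hg, Polynomial.homogenize_C_mul, Polynomial.X_pow_eq_monomial,
        Polynomial.homogenize_monomial_of_lt hi, mul_zero]
    refine ⟨g.coeff 0, i, d - i, ?_⟩
    rw [← Polynomial.homogenize_X_pow hi, ← Polynomial.homogenize_C_mul, ← hg, hfq]

/-- A Hermitian monomial has a real coefficient and equal exponents. -/
lemma hermitian_monomial {c : ℂ} {i j : ℕ} (hc : c ≠ 0)
    (h : ∀ z : ℂ, (c * (z ^ i * (starRingEnd ℂ) z ^ j)).im = 0) : c.im = 0 ∧ i = j := by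
  have him : c.im = 0 := by simpa using h 1
  refine ⟨him, ?_⟩
  by_contra hij
  have hij₂ : (i : ℂ) - j ≠ 0 := sub_ne_zero.2 (by exact_mod_cast hij)
  set t : ℝ := Real.pi / (2 * (i - j)) with ht
  have hz := h (Complex.exp (t * Complex.I))
  have hexp : Complex.exp (t * Complex.I) ^ i *
      (starRingEnd ℂ) (Complex.exp (t * Complex.I)) ^ j = Complex.I := by
    rw [← Complex.exp_conj, ← Complex.exp_nat_mul, ← Complex.exp_nat_mul, ← Complex.exp_add]
    refine Eq.trans (congrArg Complex.exp ?_) Complex.exp_pi_div_two_mul_I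
    simp only [map_mul, Complex.conj_ofReal, Complex.conj_I, ht]
    push_cast
    field_simp
    ring
  rw [hexp, Complex.mul_I_im] at hz
  exact hc (Complex.ext hz him)

/-- for a nonconstant Hermitian homogeneous `q ∈ ℂ[z,ζ]` which is not of the
form `c₀ z^m ζ^m` (`c₀ ∈ ℝ`, `m ≥ 1`), the rational function
`[q⁻¹∂_z∂_ζ]²(q⁻³Q) − q⁻⁴Q·∂_z∂_ζ(q⁻³Q) − q⁻¹(∂_ζ(q⁻³Q))(∂_z(q⁻³Q))` is not identically
zero; equivalently (clearing the denominator `q⁹`) its numerator `b3num q` is nonzero. -/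
theorem b3_expression_nonzero (q : MvPolynomial (Fin 2) ℂ) (d : ℕ)
    (hhom : q.IsHomogeneous d)
    (hnonconst : ¬ ∃ c : ℂ, q = C c)
    (hherm : ∀ z : ℂ, (eval ![z, (starRingEnd ℂ) z] q).im = 0)
    (hnotmono : ∀ (c₀ : ℝ) (m : ℕ), 1 ≤ m → q ≠ C (c₀ : ℂ) * (X 0 * X 1) ^ m) :
    b3num q ≠ 0 := by
  have hq : q ≠ 0 := fun h ↦ hnonconst ⟨0, by rw [h, C_0]⟩
  rcases exists_eq_monomial_or_linear_dvd hhom hq with ⟨c, i, j, rfl⟩ | ⟨a, ha, hdvd⟩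
  · have hc : c ≠ 0 := by
      rintro rfl
      simp at hq
    obtain ⟨him, rfl⟩ := hermitian_monomial hc (i := i) (j := j) (by simpa using hherm)
    have hi : 1 ≤ i := by
      by_contra! hi
      obtain rfl : i = 0 := by omega
      exact hnonconst ⟨c, by simp⟩
    have hre : ((c.re : ℝ) : ℂ) = c := Complex.ext rfl (by simp [him])
    exact absurd (by rw [hre, mul_pow]) (hnotmono c.re i hi)
  · have hL := prime_X_sub_C_mul_X a
    obtain ⟨k, h, hnd, hk⟩ := WfDvdMonoid.max_power_factor hq hL.irreducible
    obtain ⟨k, rfl⟩ : ∃ l, k = l + 1 := by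
      refine Nat.exists_eq_succ_of_ne_zero ?_
      rintro rfl
      exact hnd (by simpa [hk] using hdvd)
    rw [hk]
    refine (hasLeadingTerm_b3num (a := a) ?_ ?_ k).ne_zero hL hnd ?_
    · simp [pderiv_X]
    · simp [pderiv_X]
    · refine mul_ne_zero (mul_ne_zero (by exact_mod_cast k.succ_ne_zero) (pow_ne_zero 3 ha)) ?_
      norm_cast
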